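/- Weighted L^∞ bound for H∂_y: for every 0 ≤ α ≤ 2 there is a constant such that for all f ∈ C²(ℝ) with the right-hand norms finite, ‖⟨y⟩^α H∂_y(⟨y⟩^{-α} f)‖_{L^∞} ≲ ‖f‖_{L^∞} + ‖f'(y)⟨y⟩^{-1}‖_{L^∞} + ‖f''‖_{L^∞}. Consequently, the operator 𝓛_c = c − H∂_y − cQ(c·) preserves decay up to quadratic order. -/

import Mathlib

noncomputable section

open MeasureTheory Real Set

/-- Fourier transform with the convention `f̂(ξ) = ∫ e^{-ixξ} f(x) dx`. -/
def FT (f : ℝ → ℂ) (ξ : ℝ) : ℂ :=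
  ∫ x : ℝ, Complex.exp (-(Complex.I * x * ξ)) * f x

/-- Inverse Fourier transform `ǧ(x) = (2π)⁻¹ ∫ e^{ixξ} g(ξ) dξ`. -/
def IFT (g : ℝ → ℂ) (x : ℝ) : ℂ :=
  (2 * (Real.pi : ℂ))⁻¹ * ∫ ξ : ℝ, Complex.exp (Complex.I * x * ξ) * g ξ

/-- A Fourier multiplier operator with symbol `m`, acting on real-valued functions. -/
def fmul (m : ℝ → ℂ) (f : ℝ → ℝ) : ℝ → ℝ :=
  fun x => (IFT (fun ξ => m ξ * FT (fun y => (f y : ℂ)) ξ) x).re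

/-- The Hilbert transform: the Fourier multiplier with symbol `i · sgn ξ`. -/
def Hil : (ℝ → ℝ) → ℝ → ℝ :=
  fmul fun ξ => Complex.I * ((Real.sign ξ : ℝ) : ℂ)

/-- `D`, the Fourier multiplier with symbol `|ξ|`. -/
def Dop : (ℝ → ℝ) → ℝ → ℝ := fmul fun ξ => ((|ξ| : ℝ) : ℂ)

/-- `⟨D⟩^{1/2}`, the Fourier multiplier with symbol `(1+ξ²)^{1/4}`. -/
def braDhalf : (ℝ → ℝ) → ℝ → ℝ :=
  fmul fun ξ => (((1 + ξ^2) ^ ((1:ℝ)/4) : ℝ) : ℂ)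

/-- `𝒟_γ⁻¹`, the Fourier multiplier with symbol `(1+iγξ)⁻¹`. -/
def Dginv (γ : ℝ) : (ℝ → ℝ) → ℝ → ℝ :=
  fmul fun ξ => (1 + Complex.I * (γ : ℂ) * (ξ : ℂ))⁻¹

/-- The Benjamin–Ono soliton profile `Q(y) = 4/(1+y²)`. -/
def Q (y : ℝ) : ℝ := 4 / (1 + y^2)

/-- Rescaled/translated soliton `Q_{a,c}(x) = c Q(c(x−a))`. -/
def Qac (a c x : ℝ) : ℝ := c * Q (c * (x - a))

/-- Rescaled soliton `Q_c(y) = c Q(cy)`. -/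
def Qc (c : ℝ) : ℝ → ℝ := fun y => c * Q (c * y)

/-- The linearized operator `𝓛 = I − H∂_y − Q`. -/
def Lop (f : ℝ → ℝ) : ℝ → ℝ :=
  fun y => f y - Hil (deriv f) y - Q y * f y

/-- The scaled linearized operator `𝓛_c = c − H∂_y − cQ(c·)`. -/
def Lc (c : ℝ) (f : ℝ → ℝ) : ℝ → ℝ :=
  fun y => c * f y - Hil (deriv f) y - Qc c y * f y

/-- Real `L²(ℝ)` inner product. -/
def ip (f g : ℝ → ℝ) : ℝ := ∫ y : ℝ, f y * g y

/-- Squared `L²(ℝ)` norm. -/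
def L2sq (f : ℝ → ℝ) : ℝ := ∫ y : ℝ, (f y)^2

/-- `L²(ℝ)` norm. -/
def L2norm (f : ℝ → ℝ) : ℝ := Real.sqrt (L2sq f)

/-- Squared `H^s(ℝ)` norm, `‖f‖²_{H^s} = (2π)⁻¹ ∫ (1+ξ²)^s |f̂(ξ)|² dξ`. -/
def HnormSq (s : ℝ) (f : ℝ → ℝ) : ℝ :=
  (2 * Real.pi)⁻¹ * ∫ ξ : ℝ, (1 + ξ^2) ^ s * ‖FT (fun y => (f y : ℂ)) ξ‖^2

/-- `H^s(ℝ)` norm. -/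
def Hnorm (s : ℝ) (f : ℝ → ℝ) : ℝ := Real.sqrt (HnormSq s f)

/-- The projection-type term `ℙv = ‖Q'‖⁻²_{L²} ⟨v, 𝓛 Q''⟩ Q'`. -/
def Pproj (v : ℝ → ℝ) : ℝ → ℝ :=
  fun y => (ip v (Lop (deriv (deriv Q))) / L2sq (deriv Q)) * deriv Q y

/-- `g_{γ,y₀}(y) = γ⁻¹ arctan(γ(y−y₀))`. -/
def gArc (γ y₀ y : ℝ) : ℝ := γ⁻¹ * Real.arctan (γ * (y - y₀))

/-- `g'_{γ,y₀}(y) = (1+γ²(y−y₀)²)⁻¹`. -/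
def gArcD (γ y₀ y : ℝ) : ℝ := (1 + γ^2 * (y - y₀)^2)⁻¹

/-- Japanese bracket `⟨y⟩ = (1+y²)^{1/2}`. -/
def jap (y : ℝ) : ℝ := Real.sqrt (1 + y^2)

/-- The right-hand side of the perturbed Benjamin–Ono equation (pBO),
`∂_x(−H∂_x φ + W(h·)φ − ½φ²)`. -/
def pBOrhs (W : ℝ → ℝ) (h : ℝ) (φ : ℝ → ℝ) : ℝ → ℝ :=
  fun x => deriv (fun x' => -(Hil (deriv φ) x') + W (h * x') * φ x' - (φ x')^2 / 2) x

end

noncomputable section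

open MeasureTheory Real Set

/-- The majorant used in the far region. -/
def farMaj (x t : ℝ) : ℝ :=
  12 * (1 + t^2)⁻¹ + 2 * (1 + (x + t)^2)⁻¹ + 2 * (1 + (x - t)^2)⁻¹

lemma farMaj_int (x : ℝ) : Integrable (farMaj x) ∧ ∫ t, farMaj x t = 16 * π := by
  have h0 := integrable_inv_one_add_sq
  have h1 : Integrable (fun t : ℝ => (1 + (x + t)^2)⁻¹) := h0.comp_add_left x
  have h2 : Integrable (fun t : ℝ => (1 + (x - t)^2)⁻¹) := h0.comp_sub_left x
  have e1 : ∫ t : ℝ, (1 + (x + t)^2)⁻¹ = π := by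
    rw [integral_add_left_eq_self (fun t : ℝ => (1 + t^2)⁻¹) x]; exact integral_univ_inv_one_add_sq
  have e2 : ∫ t : ℝ, (1 + (x - t)^2)⁻¹ = π := by
    rw [integral_sub_left_eq_self (fun t : ℝ => (1 + t^2)⁻¹) volume x]
    exact integral_univ_inv_one_add_sq
  have i01 : Integrable (fun t : ℝ => 12 * (1 + t^2)⁻¹ + 2 * (1 + (x + t)^2)⁻¹) :=
    (h0.const_mul 12).add (h1.const_mul 2)
  refine ⟨i01.add (h2.const_mul 2), ?_⟩
  unfold farMaj
  rw [integral_add i01 (h2.const_mul 2), integral_add (h0.const_mul 12) (h1.const_mul 2),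
    integral_const_mul, integral_const_mul, integral_const_mul, e1, e2,
    integral_univ_inv_one_add_sq]
  ring

lemma farMaj_nonneg (x t : ℝ) : 0 ≤ farMaj x t := by unfold farMaj; positivity

lemma kernel_bound (F g : ℝ → ℝ) (hF : ∀ y, HasDerivAt F (g y) y) (hg : Integrable g)
    (x c M B ε : ℝ) (hε : 0 < ε) (hc : 0 ≤ c) (hB : ∀ y, |F y| ≤ B)
    (hnear : ∀ t, 0 < t → t ≤ 1 → |g (x + t) - g (x - t)| ≤ 2 * t * M)
    (hone : |F (x + 1) + F (x - 1)| ≤ c * 10)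
    (hfar : ∀ t, 1 < t → (t^2)⁻¹ * |F (x + t) + F (x - t)| ≤ c * farMaj x t) :
    |∫ t, t / (t^2 + ε^2) * g (x + t)| ≤ 2 * M + c * (10 + 16 * π) := by
  have hpos : ∀ t : ℝ, 0 < t^2 + ε^2 := fun t => by positivity
  have hKc : Continuous (fun t : ℝ => t / (t^2 + ε^2)) :=
    continuous_id.div (by fun_prop) (fun t => (hpos t).ne')
  have hKb : ∀ t : ℝ, ‖t / (t^2 + ε^2)‖ ≤ ε⁻¹ := by
    intro t
    rw [norm_div, Real.norm_eq_abs, Real.norm_eq_abs, abs_of_pos (hpos t), div_le_iff₀ (hpos t),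
      inv_mul_eq_div, le_div_iff₀ hε]
    nlinarith [sq_nonneg (|t| - ε), sq_abs t, sq_nonneg t, sq_nonneg (|t|+ε)]
  have hgp : Integrable (fun t => g (x + t)) := hg.comp_add_left x
  have hgm : Integrable (fun t => g (x - t)) := hg.comp_sub_left x
  have hI1 : Integrable (fun t => t / (t^2 + ε^2) * g (x + t)) :=
    hgp.bdd_mul hKc.aestronglyMeasurable (Filter.Eventually.of_forall hKb)
  have hI2 : Integrable (fun t => t / (t^2 + ε^2) * g (x - t)) :=
    hgm.bdd_mul hKc.aestronglyMeasurable (Filter.Eventually.of_forall hKb)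
  have hI : Integrable (fun t => t / (t^2 + ε^2) * (g (x + t) - g (x - t))) := by
    refine (hI1.sub hI2).congr (Filter.Eventually.of_forall fun t => ?_)
    simp only [Pi.sub_apply]; ring
  have e1 : ∫ t, t / (t^2 + ε^2) * g (x + t)
      = ∫ t in Ioi (0:ℝ), t / (t^2 + ε^2) * (g (x + t) - g (x - t)) := by
    rw [← intervalIntegral.integral_Iic_add_Ioi (b := 0) hI1.integrableOn hI1.integrableOn]
    have := integral_comp_neg_Ioi 0 (fun t => t / (t^2 + ε^2) * g (x + t))
    rw [neg_zero] at this
    rw [← this, ← integral_add _ hI1.integrableOn]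
    · congr 1; ext t; simp only [neg_sq]; ring_nf
    · have := hI2.neg.integrableOn (s := Ioi 0)
      refine this.congr (Filter.Eventually.of_forall fun t => ?_)
      simp only [Pi.neg_apply, neg_sq]; ring_nf
  have e2 : ∫ t in Ioi (0:ℝ), t / (t^2 + ε^2) * (g (x + t) - g (x - t))
      = (∫ t in Ioc (0:ℝ) 1, t / (t^2 + ε^2) * (g (x + t) - g (x - t)))
        + ∫ t in Ioi (1:ℝ), t / (t^2 + ε^2) * (g (x + t) - g (x - t)) := by
    rw [← Ioc_union_Ioi_eq_Ioi zero_le_one, setIntegral_union _ measurableSet_Ioi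
      hI.integrableOn hI.integrableOn]
    rw [Set.disjoint_left]; intro t ht ht'; exact absurd ht.2 (not_le.2 ht')
  have b1 : |∫ t in Ioc (0:ℝ) 1, t / (t^2 + ε^2) * (g (x + t) - g (x - t))| ≤ 2 * M := by
    have := norm_setIntegral_le_of_norm_le_const (μ := volume) (s := Ioc (0:ℝ) 1) (C := 2 * M)
      (f := fun t => t / (t^2 + ε^2) * (g (x + t) - g (x - t))) (by simp) ?_
    · simpa using this
    · intro t ht
      have hM : 0 ≤ 2 * t * M := (abs_nonneg _).trans (hnear t ht.1 ht.2)
      have hM0 : 0 ≤ M := by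
        have : 0 < 2 * t := by linarith [ht.1]
        exact nonneg_of_mul_nonneg_right hM this
      rw [norm_mul, Real.norm_eq_abs, Real.norm_eq_abs,
        abs_of_nonneg (div_nonneg ht.1.le (hpos t).le)]
      calc t / (t^2 + ε^2) * |g (x + t) - g (x - t)|
          ≤ t / (t^2 + ε^2) * (2 * t * M) :=
            mul_le_mul_of_nonneg_left (hnear t ht.1 ht.2) (div_nonneg ht.1.le (hpos t).le)
        _ = t^2 / (t^2 + ε^2) * (2 * M) := by ring
        _ ≤ 1 * (2 * M) := by
            apply mul_le_mul_of_nonneg_right _ (by linarith)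
            rw [div_le_one (hpos t)]; nlinarith [sq_nonneg ε]
        _ = 2 * M := one_mul _
  have hFc : Continuous F := continuous_iff_continuousAt.2 fun y => (hF y).continuousAt
  have hSd : ∀ t, HasDerivAt (fun t => F (x + t) + F (x - t)) (g (x + t) - g (x - t)) t := by
    intro t
    have h1 := (hF (x + t)).comp_const_add x t
    have h2 := (hF (x - t)).comp_const_sub x t
    have h3 := h1.add h2
    rw [← sub_eq_add_neg] at h3
    exact h3
  have hKd : ∀ t : ℝ, HasDerivAt (fun t : ℝ => t / (t^2 + ε^2))
      ((ε^2 - t^2) / (t^2 + ε^2)^2) t := by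
    intro t
    have h := (hasDerivAt_id t).div (((hasDerivAt_id t).pow 2).add_const (ε^2)) (hpos t).ne'
    refine h.congr_deriv ?_
    simp only [id, Pi.pow_apply]; congr 1; push_cast; ring
  have hK'b : ∀ t : ℝ, 0 < t → |(ε^2 - t^2) / (t^2 + ε^2)^2| ≤ (t^2)⁻¹ := by
    intro t ht
    have ht2 : 0 < t^2 := by positivity
    rw [abs_div, abs_of_pos (pow_pos (hpos t) 2), div_le_iff₀ (pow_pos (hpos t) 2)]
    rw [inv_mul_eq_div, le_div_iff₀ ht2]
    have : |ε^2 - t^2| ≤ t^2 + ε^2 := by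
      rw [abs_le]; constructor <;> nlinarith [sq_nonneg ε]
    nlinarith [sq_nonneg ε, hpos t]
  have hmaj : ∀ t, 1 < t → ‖(ε^2 - t^2) / (t^2 + ε^2)^2 * (F (x + t) + F (x - t))‖
      ≤ c * farMaj x t := by
    intro t ht
    rw [norm_mul, Real.norm_eq_abs, Real.norm_eq_abs]
    exact (mul_le_mul_of_nonneg_right (hK'b t (by linarith)) (abs_nonneg _)).trans (hfar t ht)
  have hmaji : Integrable (fun t => c * farMaj x t) := (farMaj_int x).1.const_mul c
  have hK'c : Continuous (fun t : ℝ => (ε^2 - t^2) / (t^2 + ε^2)^2) :=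
    (by fun_prop : Continuous fun t : ℝ => ε^2 - t^2).div (by fun_prop)
      (fun t => (pow_pos (hpos t) 2).ne')
  have hparts := integral_Ioi_mul_deriv_eq_deriv_mul (a := 1) (A := ℝ)
    (u := fun t : ℝ => t / (t^2 + ε^2)) (v := fun t => F (x + t) + F (x - t))
    (u' := fun t => (ε^2 - t^2) / (t^2 + ε^2)^2) (v' := fun t => g (x + t) - g (x - t))
    (a' := 1 / (1^2 + ε^2) * (F (x + 1) + F (x - 1))) (b' := 0)
    (fun t _ => hKd t) (fun t _ => hSd t) hI.integrableOn
    (by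
      refine Integrable.mono' hmaji.integrableOn ?_ ?_
      · exact (hK'c.mul (by fun_prop)).aestronglyMeasurable
      · exact (ae_restrict_mem measurableSet_Ioi).mono fun t ht => hmaj t ht)
    (by
      have : Continuous ((fun t : ℝ => t / (t^2 + ε^2)) * (fun t => F (x + t) + F (x - t))) :=
        hKc.mul (by fun_prop)
      exact (this.tendsto 1).mono_left nhdsWithin_le_nhds)
    (by
      have hB0 : 0 ≤ B := (abs_nonneg _).trans (hB 0)
      refine squeeze_zero_norm' (a := fun t : ℝ => 2 * B * t⁻¹) ?_ ?_
      · filter_upwards [Filter.eventually_gt_atTop 0] with t ht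
        simp only [Pi.mul_apply]
        rw [norm_mul, Real.norm_eq_abs, Real.norm_eq_abs,
          abs_of_nonneg (div_nonneg ht.le (hpos t).le), mul_comm]
        apply mul_le_mul _ _ (div_nonneg ht.le (hpos t).le) (by linarith)
        · calc _ ≤ |F (x + t)| + |F (x - t)| := abs_add_le _ _
            _ ≤ 2 * B := by linarith [hB (x + t), hB (x - t)]
        · rw [div_le_iff₀ (hpos t), inv_mul_eq_div, le_div_iff₀ ht]; nlinarith [sq_nonneg ε]
      · simpa using tendsto_inv_atTop_zero.const_mul (2 * B))
  have b2 : |∫ t in Ioi (1:ℝ), t / (t^2 + ε^2) * (g (x + t) - g (x - t))|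
      ≤ c * (10 + 16 * π) := by
    rw [hparts]
    have i1 : |∫ t in Ioi (1:ℝ), (ε^2 - t^2) / (t^2 + ε^2)^2 * (F (x + t) + F (x - t))|
        ≤ c * (16 * π) := by
      have h1 := norm_integral_le_of_norm_le (μ := volume.restrict (Ioi (1:ℝ)))
        hmaji.integrableOn ((ae_restrict_mem measurableSet_Ioi).mono fun t ht => hmaj t ht)
      have h2 : ∫ t in Ioi (1:ℝ), c * farMaj x t ≤ ∫ t, c * farMaj x t :=
        setIntegral_le_integral hmaji
          (Filter.Eventually.of_forall fun t => mul_nonneg hc (farMaj_nonneg x t))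
      have h3 : ∫ t, c * farMaj x t = c * ∫ t, farMaj x t := integral_const_mul c (farMaj x)
      rw [h3, (farMaj_int x).2] at h2
      exact h1.trans h2
    have i2 : |1 / (1^2 + ε^2) * (F (x + 1) + F (x - 1))| ≤ c * 10 := by
      rw [abs_mul]
      have : |1 / (1^2 + ε^2)| ≤ 1 := by
        rw [abs_of_pos (by positivity), div_le_one (by positivity)]; nlinarith [sq_nonneg ε]
      nlinarith [abs_nonneg (F (x + 1) + F (x - 1))]
    rw [abs_le] at i1 i2 ⊢
    constructor <;> linarith [i1.1, i1.2, i2.1, i2.2]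
  rw [e1, e2]
  exact (abs_add_le _ _).trans (by linarith)

/-- Regularised symbol. -/
def symb (ε ξ : ℝ) : ℂ := (Real.exp (-(ε * |ξ|)) : ℂ) * (Complex.I * ((Real.sign ξ : ℝ) : ℂ))

lemma measurable_sign' : Measurable Real.sign := by
  have : Real.sign = fun r : ℝ => if r < 0 then (-1:ℝ) else if 0 < r then 1 else 0 := by
    ext r; rfl
  rw [this]
  exact Measurable.ite measurableSet_Iio measurable_const
    (Measurable.ite measurableSet_Ioi measurable_const measurable_const)

lemma measurable_symb (ε : ℝ) : Measurable (symb ε) := by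
  unfold symb
  have := measurable_sign'
  fun_prop

lemma norm_sign_le (ξ : ℝ) : |Real.sign ξ| ≤ 1 := by
  rcases Real.sign_apply_eq ξ with h | h | h <;> rw [h] <;> norm_num

lemma norm_symb_le (ε ξ : ℝ) : ‖symb ε ξ‖ ≤ Real.exp (-(ε * |ξ|)) := by
  unfold symb
  rw [norm_mul, norm_mul, Complex.norm_I, one_mul, Complex.norm_real, Complex.norm_real,
    Real.norm_eq_abs, Real.norm_eq_abs, abs_of_pos (Real.exp_pos _)]
  exact mul_le_of_le_one_right (Real.exp_pos _).le (norm_sign_le ξ)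

lemma integrable_symb (ε : ℝ) (hε : 0 < ε) : Integrable (symb ε) := by
  have h : Integrable (fun ξ : ℝ => Real.exp (-(ε * |ξ|))) := by
    rw [← integrableOn_univ, ← Iic_union_Ioi (a := (0:ℝ))]
    refine IntegrableOn.union ?_ ?_
    · refine (integrableOn_exp_mul_Iic hε 0).congr_fun (fun ξ hξ => ?_) measurableSet_Iic
      have : ξ ≤ 0 := hξ
      simp only [abs_of_nonpos this]; congr 1; ring
    · refine (integrableOn_exp_mul_Ioi (neg_lt_zero.2 hε) 0).congr_fun (fun ξ hξ => ?_)
        measurableSet_Ioi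
      have : 0 < ξ := hξ
      simp only [abs_of_pos this]; congr 1; ring
  exact h.mono' (measurable_symb ε).aestronglyMeasurable
    (Filter.Eventually.of_forall fun ξ => norm_symb_le ε ξ)

lemma symb_integral (ε s : ℝ) (hε : 0 < ε) :
    ∫ ξ : ℝ, Complex.exp (Complex.I * s * ξ) * symb ε ξ = ((-2 * (s / (s^2 + ε^2)) : ℝ) : ℂ) := by
  have hI : Integrable (fun ξ : ℝ => Complex.exp (Complex.I * s * ξ) * symb ε ξ) := by
    refine (integrable_symb ε hε).bdd_mul (c := 1) (by fun_prop) ?_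
    refine Filter.Eventually.of_forall fun ξ => ?_
    have : Complex.I * s * ξ = ((s * ξ : ℝ) : ℂ) * Complex.I := by push_cast; ring
    rw [this, Complex.norm_exp_ofReal_mul_I]
  have r1 : (Complex.I * s - ε).re < 0 := by simp [hε]
  have r2 : (-Complex.I * s - ε).re < 0 := by simp [hε]
  have p1 : ∫ ξ in Ioi (0:ℝ), Complex.exp (Complex.I * s * ξ) * symb ε ξ
      = Complex.I * (-1 / (Complex.I * s - ε)) := by
    have := integral_exp_mul_complex_Ioi r1 0
    simp only [Complex.ofReal_zero, mul_zero, Complex.exp_zero] at this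
    rw [← this, ← integral_const_mul]
    refine setIntegral_congr_fun measurableSet_Ioi fun ξ hξ => ?_
    have hξ' : 0 < ξ := hξ
    simp only [symb, Real.sign_of_pos hξ', abs_of_pos hξ', Complex.ofReal_exp]
    rw [← mul_assoc, ← Complex.exp_add]
    push_cast
    rw [mul_one, mul_comm]; congr 2; ring
  have p2 : ∫ ξ in Iic (0:ℝ), Complex.exp (Complex.I * s * ξ) * symb ε ξ
      = -Complex.I * (-1 / (-Complex.I * s - ε)) := by
    have h := integral_comp_neg_Ioi 0 (fun ξ : ℝ => Complex.exp (Complex.I * s * ξ) * symb ε ξ)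
    rw [neg_zero] at h
    have := integral_exp_mul_complex_Ioi r2 0
    simp only [Complex.ofReal_zero, mul_zero, Complex.exp_zero] at this
    rw [← h, ← this, ← integral_const_mul]
    refine setIntegral_congr_fun measurableSet_Ioi fun ξ hξ => ?_
    have hξ' : 0 < ξ := hξ
    simp only [symb, Real.sign_of_neg (neg_lt_zero.2 hξ'), abs_neg, abs_of_pos hξ',
      Complex.ofReal_exp]
    rw [← mul_assoc, ← Complex.exp_add]
    push_cast
    rw [mul_comm]; 
    have : Complex.I * (s:ℂ) * -(ξ:ℂ) + -((ε:ℂ) * ξ) = (-Complex.I * s - ε) * ξ := by ring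
    rw [this]; ring
  rw [← intervalIntegral.integral_Iic_add_Ioi (b := 0) hI.integrableOn hI.integrableOn, p1, p2]
  have n1 : Complex.I * s - ε ≠ 0 := fun h => by rw [h] at r1; simp at r1
  have n2 : -Complex.I * s - ε ≠ 0 := fun h => by rw [h] at r2; simp at r2
  have n3 : (s:ℂ)^2 + (ε:ℂ)^2 ≠ 0 := by
    have : (s^2 + ε^2 : ℝ) ≠ 0 := by positivity
    exact_mod_cast this
  have n4 : (Complex.I * s - ε) * (-Complex.I * s - ε) = (s:ℂ)^2 + (ε:ℂ)^2 := by
    linear_combination (-(s:ℂ)^2) * Complex.I_sq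
  have : -Complex.I * (-1 / (-Complex.I * s - ε)) + Complex.I * (-1 / (Complex.I * s - ε))
     = (2 * Complex.I^2 * s) / ((Complex.I * s - ε) * (-Complex.I * s - ε)) := by
    rw [mul_div_assoc', mul_div_assoc', div_add_div _ _ n2 n1]
    congr 1 <;> ring
  rw [this, n4, Complex.I_sq]; push_cast; ring

lemma regularised (g : ℝ → ℝ) (hg : Integrable g) (ε x : ℝ) (hε : 0 < ε) :
    ∫ ξ : ℝ, Complex.exp (Complex.I * x * ξ) * (symb ε ξ * FT (fun y => (g y : ℂ)) ξ)
      = ((2 * ∫ t, t / (t^2 + ε^2) * g (x + t) : ℝ) : ℂ) := by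
  have hgc : Integrable (fun y => (g y : ℂ)) := hg.ofReal
  have hprod : Integrable (Function.uncurry fun (ξ y : ℝ) =>
      Complex.exp (Complex.I * ((x - y : ℝ) : ℂ) * ξ) * (symb ε ξ * (g y : ℂ)))
      (volume.prod volume) := by
    refine ((integrable_symb ε hε).mul_prod hgc).bdd_mul (c := 1)
      (f := fun z : ℝ × ℝ => Complex.exp (Complex.I * ((x - z.2 : ℝ) : ℂ) * z.1)) ?_ ?_
    · exact (by fun_prop : Continuous fun z : ℝ × ℝ =>
        Complex.exp (Complex.I * ((x - z.2 : ℝ) : ℂ) * z.1)).aestronglyMeasurable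
    · refine Filter.Eventually.of_forall fun z => ?_
      have : Complex.I * ((x - z.2 : ℝ) : ℂ) * z.1 = (((x - z.2) * z.1 : ℝ) : ℂ) * Complex.I := by
        push_cast; ring
      rw [this, Complex.norm_exp_ofReal_mul_I]
  have e1 : ∫ ξ : ℝ, Complex.exp (Complex.I * x * ξ) * (symb ε ξ * FT (fun y => (g y : ℂ)) ξ)
      = ∫ ξ : ℝ, ∫ y : ℝ, Complex.exp (Complex.I * ((x - y : ℝ) : ℂ) * ξ)
          * (symb ε ξ * (g y : ℂ)) := by
    congr 1; ext ξ
    unfold FT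
    rw [← integral_const_mul, ← integral_const_mul]
    congr 1; ext y
    have : Complex.exp (Complex.I * ((x - y : ℝ) : ℂ) * ξ)
        = Complex.exp (Complex.I * x * ξ) * Complex.exp (-(Complex.I * y * ξ)) := by
      rw [← Complex.exp_add]; push_cast; congr 1; ring
    rw [this]; ring
  rw [e1, integral_integral_swap hprod]
  have e2 : ∀ y : ℝ, ∫ ξ : ℝ, Complex.exp (Complex.I * ((x - y : ℝ) : ℂ) * ξ)
          * (symb ε ξ * (g y : ℂ)) = (((-2 * ((x - y) / ((x - y)^2 + ε^2))) * g y : ℝ) : ℂ) := by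
    intro y
    simp_rw [← mul_assoc]
    rw [integral_mul_const, symb_integral ε (x - y) hε]; push_cast; ring
  simp_rw [e2]
  rw [integral_complex_ofReal]
  congr 1
  rw [← integral_add_left_eq_self _ x, ← integral_const_mul]
  congr 1; ext t
  have : x - (x + t) = -t := by ring
  rw [this, neg_sq]; ring

lemma Hil_bound (g : ℝ → ℝ) (x R : ℝ) (hR : 0 ≤ R)
    (h : Integrable g → ∀ ε, 0 < ε → |∫ t, t / (t^2 + ε^2) * g (x + t)| ≤ R) :
    |Hil g x| ≤ R := by
  by_cases hg : Integrable g
  swap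
  · have : ∀ ξ, FT (fun y => (g y : ℂ)) ξ = 0 := by
      intro ξ
      refine integral_undef fun hi => hg ?_
      have h2 := hi.bdd_mul (c := 1) (f := fun y : ℝ => Complex.exp (Complex.I * y * ξ))
        (by fun_prop) (Filter.Eventually.of_forall fun y => by
          have : Complex.I * y * ξ = ((y * ξ : ℝ) : ℂ) * Complex.I := by push_cast; ring
          rw [this, Complex.norm_exp_ofReal_mul_I])
      have h3 := h2.re
      refine h3.congr (Filter.Eventually.of_forall fun y => ?_)
      simp only [← mul_assoc, ← Complex.exp_add]
      simp
    simp [Hil, fmul, IFT, this, hR]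
  set G := FT (fun y => (g y : ℂ)) with hG
  by_cases hi : Integrable (fun ξ : ℝ => Complex.exp (Complex.I * x * ξ)
      * (Complex.I * ((Real.sign ξ : ℝ) : ℂ) * G ξ))
  swap
  · simp only [Hil, fmul, IFT]
    rw [← hG, integral_undef hi]; simpa using hR
  have hlim : Filter.Tendsto (fun ε : ℝ => ∫ ξ : ℝ, Complex.exp (Complex.I * x * ξ)
      * (symb ε ξ * G ξ)) (nhdsWithin 0 (Ioi 0)) (nhds (∫ ξ : ℝ, Complex.exp (Complex.I * x * ξ)
      * (Complex.I * ((Real.sign ξ : ℝ) : ℂ) * G ξ))) := by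
    have heq : ∀ ε ξ : ℝ, Complex.exp (Complex.I * x * ξ) * (symb ε ξ * G ξ)
        = (Real.exp (-(ε * |ξ|)) : ℂ) * (Complex.exp (Complex.I * x * ξ)
      * (Complex.I * ((Real.sign ξ : ℝ) : ℂ) * G ξ)) := by
      intro ε ξ; unfold symb; ring
    simp_rw [heq]
    refine tendsto_integral_filter_of_dominated_convergence _ ?_ ?_ hi.norm ?_
    · exact Filter.Eventually.of_forall fun ε =>
        (by fun_prop : Continuous fun ξ : ℝ => (Real.exp (-(ε * |ξ|)) : ℂ)).aestronglyMeasurable.mul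
          hi.aestronglyMeasurable
    · filter_upwards [self_mem_nhdsWithin] with ε hε
      refine Filter.Eventually.of_forall fun ξ => ?_
      rw [norm_mul]
      refine mul_le_of_le_one_left (norm_nonneg _) ?_
      rw [Complex.norm_real, Real.norm_eq_abs, abs_of_pos (Real.exp_pos _), Real.exp_le_one_iff]
      have : 0 < ε := hε
      have := mul_nonneg this.le (abs_nonneg ξ)
      linarith
    · refine Filter.Eventually.of_forall fun ξ => ?_
      have hc : Continuous fun ε : ℝ => (Real.exp (-(ε * |ξ|)) : ℂ) := by fun_prop
      have := (hc.tendsto 0).mono_left (nhdsWithin_le_nhds (s := Ioi 0))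
      simpa using this.mul_const (Complex.exp (Complex.I * x * ξ)
        * (Complex.I * ((Real.sign ξ : ℝ) : ℂ) * G ξ))
  have hb : ‖∫ ξ : ℝ, Complex.exp (Complex.I * x * ξ)
      * (Complex.I * ((Real.sign ξ : ℝ) : ℂ) * G ξ)‖ ≤ 2 * R := by
    refine le_of_tendsto hlim.norm ?_
    filter_upwards [self_mem_nhdsWithin] with ε hε
    rw [regularised g hg ε x hε, Complex.norm_real, Real.norm_eq_abs, abs_mul]
    have := h hg ε hε
    rw [abs_of_pos two_pos]; linarith
  have : |Hil g x| ≤ ‖(2 * (Real.pi : ℂ))⁻¹ * ∫ ξ : ℝ, Complex.exp (Complex.I * x * ξ)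
      * (Complex.I * ((Real.sign ξ : ℝ) : ℂ) * G ξ)‖ := Complex.abs_re_le_norm _
  refine this.trans ?_
  rw [norm_mul, norm_inv, norm_mul, Complex.norm_real, Real.norm_eq_abs, abs_of_pos Real.pi_pos]
  have hpi := Real.pi_gt_three
  rw [inv_mul_le_iff₀ (by simp; positivity)]
  refine hb.trans ?_
  simp
  nlinarith

lemma sup_bound (u : ℝ → ℝ) (hu : Continuous u) (h : eLpNorm u ⊤ volume ≠ ⊤) (y : ℝ) :
    |u y| ≤ (eLpNorm u ⊤ volume).toReal := by
  have h1 : ∀ᵐ z ∂(volume : Measure ℝ), |u z| ≤ (eLpNorm u ⊤ volume).toReal := by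
    have h2 := ae_le_eLpNormEssSup (f := u) (μ := volume)
    filter_upwards [h2] with z hz
    rw [← eLpNorm_exponent_top] at hz
    have := ENNReal.toReal_mono h hz
    simpa using this
  have hd := Measure.dense_of_ae h1
  have hcl : IsClosed {z | |u z| ≤ (eLpNorm u ⊤ volume).toReal} :=
    isClosed_le (by fun_prop) continuous_const
  have := hcl.closure_eq ▸ hd.closure_eq
  exact (this ▸ mem_univ y : y ∈ {z | |u z| ≤ (eLpNorm u ⊤ volume).toReal})

/-- The weight `(1+y²)^{-α/2}`. -/
def wgt (α y : ℝ) : ℝ := (1 + y^2) ^ (-α/2)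

lemma jap_rpow (β y : ℝ) : jap y ^ β = (1 + y^2) ^ (β/2) := by
  unfold jap
  rw [Real.sqrt_eq_rpow, ← Real.rpow_mul (by positivity)]
  congr 1; ring

lemma wgt_pos (α y : ℝ) : 0 < wgt α y := by unfold wgt; positivity

lemma wgt_le (α x y : ℝ) (h0 : 0 ≤ α) (h2 : α ≤ 2) :
    wgt α y ≤ (1 + (1 + x^2) / (1 + y^2)) * ((1 + x^2) ^ (α/2))⁻¹ := by
  have hx : 0 < 1 + x^2 := by positivity
  have hy : 0 < 1 + y^2 := by positivity
  have hP : 0 < (1 + x^2) ^ (α/2) := by positivity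
  rw [← div_eq_mul_inv, le_div_iff₀ hP]
  have e : wgt α y * (1 + x^2) ^ (α/2) = ((1 + x^2) / (1 + y^2)) ^ (α/2) := by
    unfold wgt
    rw [Real.div_rpow hx.le hy.le, neg_div, Real.rpow_neg hy.le]; ring
  rw [e]
  set r := (1 + x^2) / (1 + y^2) with hr
  have hr0 : 0 < r := div_pos hx hy
  rcases le_total r 1 with h | h
  · have := Real.rpow_le_one hr0.le h (by linarith : 0 ≤ α/2); linarith
  · have := Real.rpow_le_rpow_of_exponent_le h (by linarith : α/2 ≤ 1)
    rw [Real.rpow_one] at this; linarith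

lemma ratio_near (x y : ℝ) (h : |y - x| ≤ 1) : (1 + x^2) / (1 + y^2) ≤ 4 := by
  rw [div_le_iff₀ (by positivity)]
  rw [abs_le] at h
  nlinarith [sq_nonneg (x - 2 * y), sq_nonneg (y - x), mul_nonneg (sub_nonneg.2 h.2)
    (by linarith [h.1] : (0:ℝ) ≤ 1 + (y - x))]

lemma ratio_far (x y t : ℝ) (ht : 1 < t) (h : (y - x)^2 = t^2) :
    (t^2)⁻¹ * (1 + (1 + x^2) / (1 + y^2)) ≤ 6 * (1 + t^2)⁻¹ + 2 * (1 + y^2)⁻¹ := by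
  have hy : 0 < 1 + y^2 := by positivity
  have ht2 : 0 < t^2 := by positivity
  have h1 : (t^2)⁻¹ ≤ 2 * (1 + t^2)⁻¹ := by
    rw [← div_eq_mul_inv, le_div_iff₀ (by positivity), inv_mul_le_iff₀ ht2]; nlinarith
  have h2 : (1 + x^2) / (1 + y^2) ≤ 2 + 2 * t^2 * (1 + y^2)⁻¹ := by
    rw [div_le_iff₀ hy, add_mul, mul_assoc, inv_mul_cancel₀ hy.ne']
    nlinarith [sq_nonneg (x - 2 * y)]
  calc (t^2)⁻¹ * (1 + (1 + x^2) / (1 + y^2))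
      ≤ (t^2)⁻¹ * (1 + (2 + 2 * t^2 * (1 + y^2)⁻¹)) := by gcongr
    _ = 3 * (t^2)⁻¹ + 2 * (1 + y^2)⁻¹ := by field_simp; ring
    _ ≤ _ := by linarith

/-- Logarithmic derivative of the weight. -/
def lgd (α y : ℝ) : ℝ := -α * y / (1 + y^2)

/-- Derivative of `lgd`. -/
def lgd' (α y : ℝ) : ℝ := -α * (1 - y^2) / (1 + y^2)^2

lemma wgt_deriv (α y : ℝ) : HasDerivAt (wgt α) (lgd α y * wgt α y) y := by
  have hy : 0 < 1 + y^2 := by positivity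
  have h := (((hasDerivAt_pow 2 y).const_add 1).rpow_const (p := -α/2) (Or.inl hy.ne'))
  refine h.congr_deriv ?_
  rw [Real.rpow_sub_one hy.ne']
  unfold lgd wgt
  push_cast
  field_simp

lemma lgd_deriv (α y : ℝ) : HasDerivAt (lgd α) (lgd' α y) y := by
  have hy : 0 < 1 + y^2 := by positivity
  have h := (((hasDerivAt_id y).const_mul (-α)).div ((hasDerivAt_pow 2 y).const_add 1) hy.ne')
  refine h.congr_deriv ?_
  unfold lgd'
  simp only [id]; congr 1; push_cast; ring

lemma lgd_bound (α y : ℝ) (h0 : 0 ≤ α) (h2 : α ≤ 2) : |lgd α y| * (1 + y^2) ≤ 2 * |y| := by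
  have hy : 0 < 1 + y^2 := by positivity
  unfold lgd
  rw [abs_div, abs_of_pos hy, div_mul_cancel₀ _ hy.ne', abs_mul, abs_neg, abs_of_nonneg h0]
  exact mul_le_mul_of_nonneg_right h2 (abs_nonneg y)

lemma lgd_le_one (α y : ℝ) (h0 : 0 ≤ α) (h2 : α ≤ 2) : |lgd α y| ≤ 1 := by
  have hy : 0 < 1 + y^2 := by positivity
  have := lgd_bound α y h0 h2
  by_contra hc
  nlinarith [sq_nonneg (|y| - 1), sq_abs y]

lemma lgd'_le (α y : ℝ) (h0 : 0 ≤ α) (h2 : α ≤ 2) : |lgd' α y| ≤ 2 := by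
  have hy : 0 < (1 + y^2)^2 := by positivity
  unfold lgd'
  rw [abs_div, abs_of_pos hy, div_le_iff₀ hy, abs_mul, abs_neg, abs_of_nonneg h0]
  have : |1 - y^2| ≤ (1 + y^2)^2 := by
    rw [abs_le]; constructor <;> nlinarith [sq_nonneg y, sq_nonneg (y^2)]
  exact mul_le_mul h2 this (abs_nonneg _) (by norm_num)

lemma lgd_jap (α y : ℝ) (h0 : 0 ≤ α) (h2 : α ≤ 2) : |lgd α y| * jap y ≤ 2 := by
  have hj : 0 < jap y := by unfold jap; positivity
  have hj2 : jap y ^ 2 = 1 + y^2 := Real.sq_sqrt (by positivity)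
  have hyj : |y| ≤ jap y := Real.abs_le_sqrt (by linarith)
  have := lgd_bound α y h0 h2
  rw [← hj2] at this
  by_contra hc
  push Not at hc
  nlinarith

lemma pointwise (α : ℝ) (h0 : 0 ≤ α) (h2 : α ≤ 2) (f : ℝ → ℝ) (hf : ContDiff ℝ 2 f)
    (A B D : ℝ) (hA : ∀ y, |f y| ≤ A) (hB : ∀ y, |deriv f y / jap y| ≤ B)
    (hD : ∀ y, |deriv (deriv f) y| ≤ D) (x : ℝ) :
    |Hil (deriv (fun z => jap z ^ (-α) * f z)) x|
      ≤ (50 + 16 * π) * (A + B + D) * ((1 + x^2) ^ (α/2))⁻¹ := by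
  have hA0 : 0 ≤ A := (abs_nonneg _).trans (hA 0)
  have hB0 : 0 ≤ B := (abs_nonneg _).trans (hB 0)
  have hD0 : 0 ≤ D := (abs_nonneg _).trans (hD 0)
  have hPi : 0 < ((1 + x^2) ^ (α/2))⁻¹ := by positivity
  set p := ((1 + x^2) ^ (α/2))⁻¹ with hp
  have hf1 : ∀ y, HasDerivAt f (deriv f y) y := fun y =>
    (hf.differentiable (by norm_num) y).hasDerivAt
  have hf2 : ∀ y, HasDerivAt (deriv f) (deriv (deriv f) y) y := fun y => by
    have : ContDiff ℝ 1 (deriv f) := ((contDiff_succ_iff_deriv (n := 1)).1 hf).2.2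
    exact (this.differentiable (by norm_num) y).hasDerivAt
  have hFd : ∀ y, HasDerivAt (fun z => wgt α z * f z)
      (wgt α y * (lgd α y * f y + deriv f y)) y := fun y =>
    ((wgt_deriv α y).mul (hf1 y)).congr_deriv (by ring)
  have hgd : ∀ y, HasDerivAt (fun y => wgt α y * (lgd α y * f y + deriv f y))
      (wgt α y * ((lgd α y ^ 2 + lgd' α y) * f y + 2 * (lgd α y * deriv f y)
        + deriv (deriv f) y)) y := fun y =>
    ((wgt_deriv α y).mul (((lgd_deriv α y).mul (hf1 y)).add (hf2 y))).congr_deriv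
      (by simp only [Pi.add_apply, Pi.mul_apply]; ring)
  have heq : deriv (fun z => jap z ^ (-α) * f z)
      = fun y => wgt α y * (lgd α y * f y + deriv f y) := by
    have : (fun z => jap z ^ (-α) * f z) = fun z => wgt α z * f z := by
      ext z; rw [jap_rpow]; rfl
    rw [this]; ext y; exact (hFd y).deriv
  rw [heq]
  have hg2 : ∀ y, |(lgd α y ^ 2 + lgd' α y) * f y + 2 * (lgd α y * deriv f y)
        + deriv (deriv f) y| ≤ 4 * (A + B + D) := by
    intro y
    have hj : 0 < jap y := by unfold jap; positivity
    have a1 : |(lgd α y ^ 2 + lgd' α y) * f y| ≤ 3 * A := by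
      rw [abs_mul]
      refine mul_le_mul ?_ (hA y) (abs_nonneg _) (by norm_num)
      refine (abs_add_le _ _).trans ?_
      rw [abs_pow]
      nlinarith [lgd_le_one α y h0 h2, lgd'_le α y h0 h2, abs_nonneg (lgd α y)]
    have a2 : |lgd α y * deriv f y| ≤ 2 * B := by
      have : lgd α y * deriv f y = (lgd α y * jap y) * (deriv f y / jap y) := by field_simp
      rw [this, abs_mul, abs_mul, abs_of_pos hj]
      exact mul_le_mul (lgd_jap α y h0 h2) (hB y) (abs_nonneg _) (by norm_num)
    have a3 := hD y
    rw [abs_le] at a1 a2 a3 ⊢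
    constructor <;> linarith [a1.1, a1.2, a2.1, a2.2, a3.1, a3.2]
  have hFb : ∀ y, |wgt α y * f y| ≤ A * ((1 + (1 + x^2) / (1 + y^2)) * p) := by
    intro y
    rw [abs_mul, abs_of_pos (wgt_pos α y), mul_comm]
    exact mul_le_mul (hA y) (wgt_le α x y h0 h2) (wgt_pos α y).le hA0
  have hnearw : ∀ y, |y - x| ≤ 1 → wgt α y ≤ 5 * p := fun y hy =>
    (wgt_le α x y h0 h2).trans
      (mul_le_mul_of_nonneg_right (by linarith [ratio_near x y hy]) hPi.le)
  have hN : A ≤ A + B + D := by linarith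
  have hN0 : 0 ≤ A + B + D := by linarith
  refine Hil_bound _ x _ (by positivity) fun hgi ε hε => ?_
  have key := kernel_bound (fun z => wgt α z * f z) _ hFd hgi x ((A + B + D) * p)
    (20 * (A + B + D) * p) A ε hε (by positivity) ?_ ?_ ?_ ?_
  · refine key.trans (le_of_eq ?_); ring
  · intro y
    rw [abs_mul, abs_of_pos (wgt_pos α y)]
    have : wgt α y ≤ 1 := by
      unfold wgt
      exact Real.rpow_le_one_of_one_le_of_nonpos (by nlinarith [sq_nonneg y]) (by linarith)
    nlinarith [hA y, wgt_pos α y, abs_nonneg (f y)]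
  · intro t ht0 ht1
    have := Convex.norm_image_sub_le_of_norm_hasDerivWithin_le (𝕜 := ℝ)
      (s := Icc (x - t) (x + t)) (x := x - t) (y := x + t) (C := 20 * (A + B + D) * p)
      (fun y _ => (hgd y).hasDerivWithinAt) (fun y hy => ?_) (convex_Icc _ _)
      ⟨le_rfl, by linarith⟩ ⟨by linarith, le_rfl⟩
    · rw [Real.norm_eq_abs, Real.norm_eq_abs] at this
      have e : x + t - (x - t) = 2 * t := by ring
      rw [e, abs_of_pos (by linarith : 0 < 2 * t)] at this
      linarith
    · rw [Real.norm_eq_abs, abs_mul, abs_of_pos (wgt_pos α y)]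
      have hyx : |y - x| ≤ 1 := by
        rw [abs_le]; constructor <;> linarith [hy.1, hy.2]
      calc _ ≤ (5 * p) * (4 * (A + B + D)) :=
            mul_le_mul (hnearw y hyx) (hg2 y) (abs_nonneg _) (by positivity)
        _ = _ := by ring
  · have o : ∀ y, |y - x| ≤ 1 → |wgt α y * f y| ≤ 5 * p * (A + B + D) := by
      intro y hy
      rw [abs_mul, abs_of_pos (wgt_pos α y)]
      exact mul_le_mul (hnearw y hy) ((hA y).trans hN) (abs_nonneg _) (by positivity)
    have o1 := o (x + 1) (by simp)
    have o2 := o (x - 1) (by simp)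
    refine (abs_add_le _ _).trans ?_
    linarith
  · intro t ht
    have r1 := ratio_far x (x + t) t ht (by ring)
    have r2 := ratio_far x (x - t) t ht (by ring)
    have hti : 0 < (t^2)⁻¹ := by positivity
    calc (t^2)⁻¹ * |wgt α (x + t) * f (x + t) + wgt α (x - t) * f (x - t)|
        ≤ (t^2)⁻¹ * (A * ((1 + (1 + x^2) / (1 + (x + t)^2)) * p)
          + A * ((1 + (1 + x^2) / (1 + (x - t)^2)) * p)) :=
          mul_le_mul_of_nonneg_left
            ((abs_add_le _ _).trans (add_le_add (hFb _) (hFb _))) hti.le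
      _ = A * p * ((t^2)⁻¹ * (1 + (1 + x^2) / (1 + (x + t)^2))
          + (t^2)⁻¹ * (1 + (1 + x^2) / (1 + (x - t)^2))) := by ring
      _ ≤ A * p * farMaj x t := by
          apply mul_le_mul_of_nonneg_left _ (by positivity)
          unfold farMaj; linarith
      _ ≤ (A + B + D) * p * farMaj x t :=
          mul_le_mul_of_nonneg_right (mul_le_mul_of_nonneg_right hN hPi.le) (farMaj_nonneg x t)

/-- **Weighted `L^∞` bound for `H∂_y`.** For every `0 ≤ α ≤ 2` there is a constant `C`
such that for all `f ∈ C²(ℝ)` (with the right-hand norms finite),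
`‖⟨y⟩^α H∂_y(⟨y⟩^{−α}f)‖_{L^∞} ≤ C(‖f‖_{L^∞} + ‖f'⟨y⟩⁻¹‖_{L^∞} + ‖f''‖_{L^∞})`. -/
theorem weighted_Linfty_bound_Hdy (α : ℝ) (hα₀ : 0 ≤ α) (hα₂ : α ≤ 2) :
    ∃ C : ℝ, 0 < C ∧ ∀ f : ℝ → ℝ, ContDiff ℝ 2 f →
      eLpNorm f ⊤ volume ≠ ⊤ →
      eLpNorm (fun y => deriv f y / jap y) ⊤ volume ≠ ⊤ →
      eLpNorm (deriv (deriv f)) ⊤ volume ≠ ⊤ →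
      eLpNorm (fun y => jap y ^ α * Hil (deriv (fun z => jap z ^ (-α) * f z)) y) ⊤ volume
        ≤ ENNReal.ofReal C *
          (eLpNorm f ⊤ volume
            + eLpNorm (fun y => deriv f y / jap y) ⊤ volume
            + eLpNorm (deriv (deriv f)) ⊤ volume) := by
  refine ⟨50 + 16 * π, by positivity, fun f hf h1 h2 h3 => ?_⟩
  have hjc : Continuous jap := by unfold jap; fun_prop
  have hjp : ∀ y, 0 < jap y := fun y => by unfold jap; positivity
  have hc1 : Continuous (deriv f) := hf.continuous_deriv (by norm_num)
  have hc2 : Continuous (deriv (deriv f)) :=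
    ((contDiff_succ_iff_deriv (n := 1)).1 hf).2.2.continuous_deriv (by norm_num)
  have hb := pointwise α hα₀ hα₂ f hf _ _ _ (sup_bound f hf.continuous h1)
    (sup_bound _ (hc1.div hjc fun y => (hjp y).ne') h2) (sup_bound _ hc2 h3)
  rw [eLpNorm_exponent_top (f := fun y => jap y ^ α * _)]
  refine (eLpNormEssSup_le_of_ae_bound (C := (50 + 16 * π) * ((eLpNorm f ⊤ volume).toReal
    + (eLpNorm (fun y => deriv f y / jap y) ⊤ volume).toReal
    + (eLpNorm (deriv (deriv f)) ⊤ volume).toReal)) ?_).trans (le_of_eq ?_)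
  · refine Filter.Eventually.of_forall fun x => ?_
    have hP : 0 < (1 + x^2) ^ (α/2) := by positivity
    rw [norm_mul, jap_rpow, Real.norm_eq_abs, Real.norm_eq_abs, abs_of_pos hP]
    refine (mul_le_mul_of_nonneg_left (hb x) hP.le).trans (le_of_eq ?_)
    rw [mul_comm, mul_assoc, inv_mul_cancel₀ hP.ne', mul_one]
  · rw [ENNReal.ofReal_mul (by positivity), ← ENNReal.toReal_add h1 h2,
      ← ENNReal.toReal_add (ENNReal.add_ne_top.2 ⟨h1, h2⟩) h3, ENNReal.ofReal_toReal]
    exact ENNReal.add_ne_top.2 ⟨ENNReal.add_ne_top.2 ⟨h1, h2⟩, h3⟩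

end
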